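/- arXiv:1510.05258 — 10 statements merged into one kernel-verified Lean document; each statement's English description precedes it below -/
import Mathlib

section
/- For every generic t ∈ ℂⁿ and all indices i, j, k, m, p, r ∈ {1,…,n}, the dynamical Yang–Baxter equation holds: Σ_{a,b,u} R̂^{ij}_{ab}(t) · R̂^{bk}_{ur}(t − ε_a) · R̂^{au}_{mp}(t) = Σ_{a,b,u} R̂^{jk}_{ab}(t − ε_i) · R̂^{ia}_{mu}(t) · R̂^{ub}_{pr}(t − ε_m). -/
noncomputable section

open Finset

/-- `t ∈ ℂⁿ` is generic if `t i - t j` is never an integer for `i ≠ j`. -/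
def Generic {n : ℕ} (t : Fin n → ℂ) : Prop :=
  ∀ i j : Fin n, i ≠ j → ∀ m : ℤ, t i - t j ≠ (m : ℂ)

/-- the `k`-th standard basis vector of `ℤⁿ ⊂ ℂⁿ`. -/
def eps {n : ℕ} (k : Fin n) : Fin n → ℂ := fun l => if l = k then 1 else 0

/-- Entries `R̂^{ij}_{kl}(t)` of the dynamical R-matrix: the only nonzero ones are
`R̂^{ij}_{ij} = 1/t_{ij}` for `i ≠ j`, `R̂^{ij}_{ji} = (t_{ij}² - 1)/t_{ij}²` for `i < j`
and `R̂^{ij}_{ji} = 1` for `i ≥ j`. -/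
def Rhat {n : ℕ} (t : Fin n → ℂ) (i j k l : Fin n) : ℂ :=
  (if k = i ∧ l = j ∧ i ≠ j then (t i - t j)⁻¹ else 0) +
  (if k = j ∧ l = i then
    (if i < j then ((t i - t j) ^ 2 - 1) / (t i - t j) ^ 2 else 1)
  else 0)

/-- The off-diagonal entry `R̂^{ij}_{ji}(t)` of the dynamical R-matrix. -/
def RhatFlip {n : ℕ} (t : Fin n → ℂ) (i j : Fin n) : ℂ :=
  if i < j then ((t i - t j) ^ 2 - 1) / (t i - t j) ^ 2 else 1

section

variable {n : ℕ} (t : Fin n → ℂ)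

theorem Rhat_eq (i j k l : Fin n) :
    Rhat t i j k l = (if k = i then if l = j then (t i - t j)⁻¹ else 0 else 0) +
      (if k = j then if l = i then RhatFlip t i j else 0 else 0) := by
  unfold Rhat RhatFlip
  by_cases hij : i = j
  · subst hij
    simp [ite_and]
  · simp [hij, ite_and]

theorem sum_sum_Rhat_mul (i j : Fin n) (f : Fin n → Fin n → ℂ) :
    ∑ a, ∑ b, Rhat t i j a b * f a b = (t i - t j)⁻¹ * f i j + RhatFlip t i j * f j i := by
  simp [Rhat_eq, add_mul, Finset.sum_add_distrib, ite_mul]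

theorem sum_Rhat_mul_left (i j r : Fin n) (f : Fin n → ℂ) :
    ∑ u, Rhat t i j u r * f u =
      (if r = j then (t i - t j)⁻¹ * f i else 0) + (if r = i then RhatFlip t i j * f j else 0) := by
  simp [Rhat_eq, add_mul, Finset.sum_add_distrib, ite_mul]

theorem sum_Rhat_mul_right (i j m : Fin n) (f : Fin n → ℂ) :
    ∑ u, Rhat t i j m u * f u =
      (if m = i then (t i - t j)⁻¹ * f j else 0) + (if m = j then RhatFlip t i j * f i else 0) := by
  simp only [Rhat_eq, add_mul, Finset.sum_add_distrib, ite_mul, zero_mul]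
  congr 1 <;> split_ifs <;> simp

@[simp]
theorem RhatFlip_self (i : Fin n) : RhatFlip t i i = 1 := by
  simp [RhatFlip]

theorem RhatFlip_mul_swap {i j : Fin n} (h : t i - t j ≠ 0) :
    RhatFlip t i j * RhatFlip t j i = 1 - ((t i - t j)⁻¹) ^ 2 := by
  have hij : i ≠ j := by
    rintro rfl
    simp at h
  have h' : t j - t i ≠ 0 := by rwa [← neg_sub, neg_ne_zero]
  rcases hij.lt_or_gt with hlt | hlt
  · simp only [RhatFlip, hlt, hlt.not_gt, if_true, if_false]
    field_simp
  · simp only [RhatFlip, hlt, hlt.not_gt, if_true, if_false]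
    rw [← neg_sub (t i) (t j)]
    field_simp

theorem RhatFlip_sub_eps {i j k : Fin n} (hi : i ≠ k) (hj : j ≠ k) :
    RhatFlip (t - eps k) i j = RhatFlip t i j := by
  simp [RhatFlip, eps, hi, hj]

end

/-- The dynamical Yang–Baxter equation for `R̂`. -/
theorem dynamical_Yang_Baxter_equation {n : ℕ} (hn : 2 ≤ n)
    (t : Fin n → ℂ) (ht : Generic t) (i j k m p r : Fin n) :
    ∑ a : Fin n, ∑ b : Fin n, ∑ u : Fin n,
        Rhat t i j a b * Rhat (t - eps a) b k u r * Rhat t a u m p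
    = ∑ a : Fin n, ∑ b : Fin n, ∑ u : Fin n,
        Rhat (t - eps i) j k a b * Rhat t i a m u * Rhat (t - eps m) u b p r := by
  have hL : ∑ a : Fin n, ∑ b : Fin n, ∑ u : Fin n,
        Rhat t i j a b * Rhat (t - eps a) b k u r * Rhat t a u m p =
      ∑ a, ∑ b, Rhat t i j a b * ∑ u, Rhat (t - eps a) b k u r * Rhat t a u m p := by
    simp only [mul_assoc, Finset.mul_sum]
  have hR : ∑ a : Fin n, ∑ b : Fin n, ∑ u : Fin n,
        Rhat (t - eps i) j k a b * Rhat t i a m u * Rhat (t - eps m) u b p r =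
      ∑ a, ∑ b, Rhat (t - eps i) j k a b * ∑ u, Rhat t i a m u * Rhat (t - eps m) u b p r := by
    simp only [mul_assoc, Finset.mul_sum]
  have h0 : ∀ x y : Fin n, x ≠ y → t x - t y ≠ 0 := fun x y h => by
    simpa using ht x y h 0
  have h1 : ∀ x y : Fin n, x ≠ y → t x - 1 - t y ≠ 0 := fun x y h h' =>
    ht x y h 1 (by push_cast; linear_combination h')
  have flip_mul : ∀ x y : Fin n, x ≠ y →
      RhatFlip t x y * RhatFlip t y x = 1 - ((t x - t y)⁻¹) ^ 2 :=
    fun x y h => RhatFlip_mul_swap t (h0 x y h)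
  have flip_mul_shift : ∀ x y : Fin n, x ≠ y →
      RhatFlip (t - eps x) x y * RhatFlip (t - eps x) y x = 1 - ((t x - 1 - t y)⁻¹) ^ 2 :=
    fun x y h => by
      have := RhatFlip_mul_swap (t - eps x) (i := x) (j := y) (by simpa [eps, h.symm] using h1 x y h)
      simpa [eps, h.symm] using this
  have inv_swap : ∀ x y : Fin n, (t y - t x)⁻¹ = -(t x - t y)⁻¹ := fun x y => by
    rw [← neg_sub, inv_neg]
  have inv_swap_shift : ∀ x y : Fin n, (t x - (t y - 1))⁻¹ = -(t y - 1 - t x)⁻¹ := fun x y => by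
    rw [← neg_sub, inv_neg]
  have inv_shift : ∀ x y : Fin n, x ≠ y →
      (t x - 1 - t y)⁻¹ - (t x - t y)⁻¹ = (t x - 1 - t y)⁻¹ * (t x - t y)⁻¹ := fun x y h => by
    have := h0 x y h
    have := h1 x y h
    field_simp
    ring
  have partial_fraction : ∀ x y z : Fin n, x ≠ y → y ≠ z → x ≠ z →
      (t x - t y)⁻¹ * (t y - t z)⁻¹ = (t x - t z)⁻¹ * ((t x - t y)⁻¹ + (t y - t z)⁻¹) :=
    fun x y z hxy hyz hxz => by
      have := h0 x y hxy
      have := h0 y z hyz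
      have := h0 x z hxz
      field_simp
      ring
  rw [hL, hR, sum_sum_Rhat_mul, sum_sum_Rhat_mul]
  clear hL hR
  simp only [sum_Rhat_mul_left, sum_Rhat_mul_right]
  simp only [Rhat_eq]
  by_cases hij : i = j
  · subst hij
    by_cases hik : i = k
    · subst hik
      simp
      split_ifs <;> simp_all [-inv_swap, -inv_swap_shift, -inv_shift, -partial_fraction, -flip_mul, -flip_mul_shift]
    · have hki := Ne.symm hik
      by_cases hmi : m = i <;> by_cases hmk : m = k <;> by_cases hpi : p = i <;>
        by_cases hpk : p = k <;> by_cases hri : r = i <;> by_cases hrk : r = k <;>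
        (try subst m) <;> (try subst p) <;> (try subst r) <;>
        simp [eps, *, -inv_swap, -inv_swap_shift,
          -inv_shift, -partial_fraction, -flip_mul, -flip_mul_shift]
      all_goals grind only
  · have hji := Ne.symm hij
    by_cases hik : i = k
    · subst hik
      by_cases hmi : m = i <;> by_cases hmj : m = j <;> by_cases hpi : p = i <;>
        by_cases hpj : p = j <;> by_cases hri : r = i <;> by_cases hrj : r = j <;>
        (try subst m) <;> (try subst p) <;> (try subst r) <;>
        simp [eps, *, -inv_swap, -inv_swap_shift,
          -inv_shift, -partial_fraction, -flip_mul, -flip_mul_shift]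
      all_goals grind only
    · have hki := Ne.symm hik
      by_cases hjk : j = k
      · subst hjk
        by_cases hmi : m = i <;> by_cases hmj : m = j <;> by_cases hpi : p = i <;>
          by_cases hpj : p = j <;> by_cases hri : r = i <;> by_cases hrj : r = j <;>
          (try subst m) <;> (try subst p) <;> (try subst r) <;>
          simp [eps, *, -inv_swap, -inv_swap_shift,
          -inv_shift, -partial_fraction, -flip_mul, -flip_mul_shift]
        all_goals grind only
      · have hkj := Ne.symm hjk
        by_cases hmi : m = i <;> by_cases hmj : m = j <;> by_cases hmk : m = k <;>
          (try subst m) <;> (try contradiction) <;>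
          by_cases hpi : p = i <;> by_cases hpj : p = j <;> by_cases hpk : p = k <;>
          (try subst p) <;> (try contradiction) <;>
          by_cases hri : r = i <;> by_cases hrj : r = j <;> by_cases hrk : r = k <;>
          (try subst r) <;> (try contradiction) <;> simp [RhatFlip_sub_eps, eps, *, -inv_swap, -inv_swap_shift,
          -inv_shift, -partial_fraction, -flip_mul, -flip_mul_shift]
        all_goals grind only
end
end

section
/- For every generic t ∈ ℂⁿ and all indices i, j, m, p ∈ {1,…,n}: Σ_{k,l} R̂^{ij}_{kl}(t) · R̂^{kl}_{mp}(t) = δ^i_m δ^j_p; that is, the operator R̂(t) on ℂⁿ ⊗ ℂⁿ squares to the identity. -/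
noncomputable section

open Finset

/-- Contracting `R̂^{ij}` with an array only sees the entries at `(i, j)` and `(j, i)`. -/
theorem sum_Rhat_mul {n : ℕ} (t : Fin n → ℂ) (i j : Fin n) (f : Fin n → Fin n → ℂ) :
    ∑ k : Fin n, ∑ l : Fin n, Rhat t i j k l * f k l =
      (if i ≠ j then (t i - t j)⁻¹ else 0) * f i j +
      (if i < j then ((t i - t j) ^ 2 - 1) / (t i - t j) ^ 2 else 1) * f j i := by
  simp only [Rhat, add_mul, sum_add_distrib, ite_and, ite_mul, zero_mul, sum_ite_irrel,
    sum_const_zero, sum_ite_eq', mem_univ, if_true]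

/-- `R̂(t)` squares to the identity. -/
theorem Rhat_sq_eq_id {n : ℕ} (hn : 2 ≤ n) (t : Fin n → ℂ) (ht : Generic t)
    (i j m p : Fin n) :
    ∑ k : Fin n, ∑ l : Fin n, Rhat t i j k l * Rhat t k l m p
    = if i = m ∧ j = p then 1 else 0 := by
  rw [sum_Rhat_mul]
  rcases eq_or_ne i j with rfl | hij
  · simp [Rhat, eq_comm, and_comm]
  have hne : t i - t j ≠ 0 := by simpa using ht i j hij 0
  have hinv : (t j - t i)⁻¹ = -(t i - t j)⁻¹ := by rw [← neg_sub, inv_neg]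
  have hsq : (t j - t i) ^ 2 = (t i - t j) ^ 2 := by ring
  simp only [Rhat, hinv, hsq]
  by_cases h₁ : m = i ∧ p = j
  · obtain ⟨rfl, rfl⟩ := h₁
    rcases lt_or_gt_of_ne hij with h | h
    · simp [hij, hij.symm, h, h.not_gt]
      field_simp
      ring
    · simp [hij, hij.symm, h, h.not_gt]
      field_simp
      ring
  by_cases h₂ : m = j ∧ p = i
  · obtain ⟨rfl, rfl⟩ := h₂
    rcases lt_or_gt_of_ne hij with h | h
    · simp [hij, hij.symm, h]
      field_simp
      ring
    · simp [hij, hij.symm, h.not_gt]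
  grind
end
end

section
/- For every generic t ∈ ℂⁿ and all indices i, j, k, l ∈ {1,…,n}: T̂^{kl}_{ij}(t − ε_l) = R̂^{lk}_{ji}(t). -/
noncomputable section

open Finset

/-- Entries `T̂^{ij}_{kl}(t)`: the only nonzero ones are
`T̂^{ij}_{ij} = -1/(t_{ij} - 1)` for `i ≠ j`, `T̂^{ji}_{ij} = t_{ij}(t_{ij}+2)/(t_{ij}+1)²`
for `i < j` and `T̂^{ji}_{ij} = 1` for `i ≥ j`. -/
def That {n : ℕ} (t : Fin n → ℂ) (a b c d : Fin n) : ℂ :=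
  (if c = a ∧ d = b ∧ a ≠ b then -((t a - t b) - 1)⁻¹ else 0) +
  (if a = d ∧ b = c then
    (if c < d then (t c - t d) * ((t c - t d) + 2) / ((t c - t d) + 1) ^ 2 else 1)
  else 0)

/-- `T̂^{kl}_{ij}(t - ε_l) = R̂^{lk}_{ji}(t)`. -/
theorem That_shift_eq_Rhat {n : ℕ} (hn : 2 ≤ n) (t : Fin n → ℂ) (ht : Generic t)
    (i j k l : Fin n) :
    That (t - eps l) k l i j = Rhat t l k j i := by
  unfold That Rhat
  congr 1
  · by_cases h : i = k ∧ j = l ∧ k ≠ l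
    · obtain ⟨rfl, rfl, hij⟩ := h
      simp [eps, hij, Ne.symm hij, ← inv_neg]
      ring
    · rw [if_neg h, if_neg fun h' => h ⟨h'.2.1, h'.1, h'.2.2.symm⟩]
  · by_cases h : k = j ∧ l = i
    · obtain ⟨rfl, rfl⟩ := h
      simp only [and_self, if_true]
      split_ifs with hlt
      · simp only [eps, Pi.sub_apply, if_true, if_neg hlt.ne']
        ring
      · rfl
    · rw [if_neg h, if_neg fun h' => h ⟨h'.1.symm, h'.2.symm⟩]
end
end

section
/- For every generic t ∈ ℂⁿ and all indices i, j, m, p ∈ {1,…,n}: Σ_{k,l} Ψ̂^{ik}_{jl}(t) · T̂^{lm}_{kp}(t) = δ^i_p δ^m_j; that is, Ψ̂ is the skew inverse of T̂. -/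
noncomputable section

open Finset

/-- `Q⁺_i(t) = ∏_{k ≠ i} (t_{ik} + 1)/t_{ik}`. -/
def Qp {n : ℕ} (t : Fin n → ℂ) (i : Fin n) : ℂ :=
  ∏ k ∈ Finset.univ.filter (fun k => k ≠ i), ((t i - t k) + 1) / (t i - t k)

/-- `Q⁻_i(t) = ∏_{k ≠ i} (t_{ik} - 1)/t_{ik}`. -/
def Qm {n : ℕ} (t : Fin n → ℂ) (i : Fin n) : ℂ :=
  ∏ k ∈ Finset.univ.filter (fun k => k ≠ i), ((t i - t k) - 1) / (t i - t k)

/-- Entries `Ψ̂^{ij}_{kl}(t)`: the only nonzero ones are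
`Ψ̂^{ij}_{ij} = Q⁺_i Q⁻_j/(t_{ij} + 1)` for all `i, j`, `Ψ̂^{ij}_{ji} = 1` for `i < j`
and `Ψ̂^{ij}_{ji} = (t_{ij} - 1)²/(t_{ij}(t_{ij} - 2))` for `i > j`. -/
def Psi {n : ℕ} (t : Fin n → ℂ) (a b c d : Fin n) : ℂ :=
  (if c = a ∧ d = b then Qp t a * Qm t b / ((t a - t b) + 1) else 0) +
  (if c = b ∧ d = a ∧ a ≠ b then
    (if a < b then 1 else ((t a - t b) - 1) ^ 2 / ((t a - t b) * ((t a - t b) - 2)))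
  else 0)

theorem Generic.injective {n : ℕ} {t : Fin n → ℂ} (ht : Generic t) : Function.Injective t := by
  intro a b hab
  by_contra hne
  exact ht a b hne 0 (by simp [hab])

theorem Generic.sub_add_intCast_ne_zero {n : ℕ} {t : Fin n → ℂ} (ht : Generic t) {a b : Fin n}
    {m : ℤ} (hm : m ≠ 0) : t a - t b + m ≠ 0 := by
  rcases eq_or_ne a b with rfl | hab
  · simpa using hm
  · intro h
    exact ht a b hab (-m) (by push_cast; linear_combination h)

theorem Generic.sub_add_one_ne_zero {n : ℕ} {t : Fin n → ℂ} (ht : Generic t) (a b : Fin n) :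
    t a - t b + 1 ≠ 0 := by
  simpa using ht.sub_add_intCast_ne_zero (a := a) (b := b) one_ne_zero

theorem Generic.sub_sub_one_ne_zero {n : ℕ} {t : Fin n → ℂ} (ht : Generic t) (a b : Fin n) :
    t a - t b - 1 ≠ 0 := by
  simpa [sub_eq_add_neg] using
    ht.sub_add_intCast_ne_zero (a := a) (b := b) (m := -1) (by norm_num)

theorem Generic.sub_sub_two_ne_zero {n : ℕ} {t : Fin n → ℂ} (ht : Generic t) (a b : Fin n) :
    t a - t b - 2 ≠ 0 := by
  simpa [sub_eq_add_neg] using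
    ht.sub_add_intCast_ne_zero (a := a) (b := b) (m := -2) (by norm_num)

theorem Qp_eq_prod_erase {n : ℕ} (t : Fin n → ℂ) (i : Fin n) :
    Qp t i = (∏ l ∈ univ.erase i, (t i + 1 - t l)) / ∏ l ∈ univ.erase i, (t i - t l) := by
  rw [Qp, filter_ne', ← prod_div_distrib]
  exact prod_congr rfl fun l _ => by ring

theorem Qm_eq_nodalWeight_mul {n : ℕ} (t : Fin n → ℂ) (k : Fin n) :
    Qm t k = Lagrange.nodalWeight univ t k * ∏ l ∈ univ.erase k, (t k - (t l + 1)) := by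
  rw [Qm, filter_ne', Lagrange.nodalWeight, ← prod_mul_distrib]
  exact prod_congr rfl fun l _ => by ring

/-- Lagrange interpolation at the nodes `t k` of `∏_{l ≠ m} (z - t l - 1)`, evaluated at
`z = t i + 1`. -/
theorem sum_Qp_mul_Qm {n : ℕ} {t : Fin n → ℂ} (ht : Generic t) (i m : Fin n) :
    ∑ k, Qp t i * Qm t k / (t i - t k + 1) * -(t k - t m - 1)⁻¹ = if i = m then 1 else 0 := by
  have hD : ∏ l ∈ univ.erase i, (t i - t l) ≠ 0 :=
    prod_ne_zero_iff.2 fun l hl => sub_ne_zero.2 (ht.injective.ne (ne_of_mem_erase hl).symm)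
  have hcard : (Lagrange.nodal (univ.erase m) fun l => t l + 1).degree <
      #(univ : Finset (Fin n)) := by
    rw [Lagrange.degree_nodal]
    exact_mod_cast card_erase_lt_of_mem (mem_univ m)
  have key := Lagrange.eval_interpolate_not_at_node (s := univ) (v := t) (x := t i + 1)
    (fun k => (Lagrange.nodal (univ.erase m) fun l => t l + 1).eval (t k))
    (fun k _ h => ht.sub_add_one_ne_zero i k (by linear_combination h))
  rw [← Lagrange.eq_interpolate ht.injective.injOn hcard] at key
  simp only [Lagrange.eval_nodal] at key
  have hQp : ∏ l, (t i + 1 - t l) = Qp t i * ∏ l ∈ univ.erase i, (t i - t l) := by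
    rw [Qp_eq_prod_erase, div_mul_cancel₀ _ hD, ← mul_prod_erase univ _ (mem_univ i)]
    ring
  have hterm (k : Fin n) : Lagrange.nodalWeight univ t k * (t i + 1 - t k)⁻¹ *
      ∏ l ∈ univ.erase m, (t k - (t l + 1)) = Qm t k / (t i - t k + 1) * -(t k - t m - 1)⁻¹ := by
    have hkm := ht.sub_sub_one_ne_zero k m
    have hm := mul_prod_erase univ (fun l => t k - (t l + 1)) (mem_univ m)
    rw [← mul_prod_erase univ _ (mem_univ k)] at hm
    have hprod : ∏ l ∈ univ.erase m, (t k - (t l + 1)) =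
        (∏ l ∈ univ.erase k, (t k - (t l + 1))) * -(t k - t m - 1)⁻¹ := by
      field_simp
      linear_combination hm
    rw [hprod, Qm_eq_nodalWeight_mul, show t i + 1 - t k = t i - t k + 1 by ring]
    ring
  have hlhs : ∏ l ∈ univ.erase m, (t i + 1 - (t l + 1)) =
      (if i = m then 1 else 0) * ∏ l ∈ univ.erase i, (t i - t l) := by
    simp only [add_sub_add_right_eq_sub]
    split_ifs with h
    · rw [h, one_mul]
    · rw [zero_mul]
      exact prod_eq_zero (mem_erase.2 ⟨h, mem_univ i⟩) (sub_self _)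
  rw [hlhs, hQp, sum_congr rfl fun k _ => hterm k, mul_right_comm] at key
  rw [mul_right_cancel₀ hD key, mul_sum]
  exact sum_congr rfl fun k _ => by ring

theorem Psi_self {n : ℕ} (t : Fin n → ℂ) (i k l : Fin n) :
    Psi t i k i l = if l = k then Qp t i * Qm t k / (t i - t k + 1) else 0 := by
  unfold Psi
  grind

theorem Psi_of_ne {n : ℕ} (t : Fin n → ℂ) {i j : Fin n} (hij : i ≠ j) (k l : Fin n) :
    Psi t i k j l = if k = j ∧ l = i then
      (if i < j then 1 else (t i - t j - 1) ^ 2 / ((t i - t j) * (t i - t j - 2))) else 0 := by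
  unfold Psi
  grind

theorem That_diagonal {n : ℕ} (t : Fin n → ℂ) (k m p : Fin n) :
    That t k m k p = if p = m then -(t k - t m - 1)⁻¹ else 0 := by
  unfold That
  by_cases hpm : p = m <;> by_cases hkm : k = m <;> simp_all <;> grind

theorem That_crossed {n : ℕ} (t : Fin n → ℂ) {i j : Fin n} (hij : i ≠ j) (m p : Fin n) :
    That t i m j p = if i = p ∧ m = j then
      (if j < i then (t j - t i) * (t j - t i + 2) / (t j - t i + 1) ^ 2 else 1) else 0 := by
  unfold That
  grind

/-- `Ψ̂` is the skew inverse of `T̂`: `Σ_{k,l} Ψ̂^{ik}_{jl}(t) T̂^{lm}_{kp}(t) = δ^i_p δ^m_j`. -/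
theorem Psi_skew_inverse_That {n : ℕ} (hn : 2 ≤ n) (t : Fin n → ℂ) (ht : Generic t)
    (i j m p : Fin n) :
    ∑ k : Fin n, ∑ l : Fin n, Psi t i k j l * That t l m k p
    = if i = p ∧ m = j then 1 else 0 := by
  rcases eq_or_ne i j with rfl | hij
  · simp only [Psi_self, ite_mul, zero_mul, sum_ite_eq', mem_univ, if_true, That_diagonal]
    rcases eq_or_ne p m with rfl | hpm
    · simp only [if_true, sum_Qp_mul_Qm ht]
      grind
    · simp only [if_neg hpm, mul_zero, sum_const_zero]
      grind
  · simp only [Psi_of_ne t hij, ite_and, ite_mul, zero_mul]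
    rw [sum_eq_single j (fun k _ hk => by simp [hk]) (by simp)]
    simp only [if_true, sum_ite_eq', mem_univ, That_crossed t hij]
    rcases lt_or_gt_of_ne hij with h | h
    · simp [h, h.not_gt, ite_and]
    · have h0 : t i - t j ≠ 0 := sub_ne_zero.2 (ht.injective.ne hij)
      have h1 := ht.sub_sub_one_ne_zero i j
      have h2 := ht.sub_sub_two_ne_zero i j
      have h3 := ht.sub_add_one_ne_zero j i
      have hinv : (t i - t j - 1) ^ 2 / ((t i - t j) * (t i - t j - 2)) *
          ((t j - t i) * (t j - t i + 2) / (t j - t i + 1) ^ 2) = 1 := by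
        field_simp
        ring
      simp only [h, h.not_gt, if_true, if_false, mul_ite, hinv, mul_zero, ite_and]
end
end

section
/- For every generic t ∈ ℂⁿ and all indices i, j ∈ {1,…,n}: Σ_k Ψ̂^{ik}_{jk}(t) = Q⁺_i(t) δ^i_j; that is, the trace of Ψ̂ over the second tensor factor equals the diagonal matrix Q⁺. -/
noncomputable section

open Finset

/-- Partial fraction expansion of `∏ k, (x - t k - 1) / (x - t k)`, obtained by Lagrange
interpolation at the nodes `t k`. -/
theorem sum_Qm_div_sub {n : ℕ} {t : Fin n → ℂ} (ht : Function.Injective t) {x : ℂ}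
    (hx : ∀ k, x ≠ t k) :
    ∑ k, Qm t k / (x - t k) = 1 - ∏ k, (x - t k - 1) / (x - t k) := by
  set N := Lagrange.nodal univ t
  set P := Lagrange.nodal univ fun k => t k + 1
  have hdeg : (N - P).degree < #(univ : Finset (Fin n)) := by
    rw [← Lagrange.degree_nodal (s := univ) (v := t)]
    exact Polynomial.degree_sub_lt_left (by rw [Lagrange.degree_nodal, Lagrange.degree_nodal])
      Lagrange.nodal_ne_zero
      (Lagrange.nodal_monic.leadingCoeff.trans Lagrange.nodal_monic.leadingCoeff.symm)
  have hN : N.eval x ≠ 0 := Lagrange.eval_nodal_not_at_node fun k _ => hx k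
  have hnode (k : Fin n) :
      Lagrange.nodalWeight univ t k * (N - P).eval (t k) = Qm t k := by
    rw [Polynomial.eval_sub, Lagrange.eval_nodal_at_node (mem_univ k), Lagrange.eval_nodal,
      ← mul_prod_erase univ _ (mem_univ k), Lagrange.nodalWeight, Qm, filter_ne']
    simp_rw [div_eq_mul_inv, prod_mul_distrib, sub_sub]
    ring
  have hinterp := congrArg (Polynomial.eval x) (Lagrange.eq_interpolate (ht.injOn) hdeg)
  rw [Lagrange.eval_interpolate_not_at_node _ fun k _ => hx k] at hinterp
  have hsum : ∑ k, Qm t k / (x - t k) = (N - P).eval x / N.eval x := by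
    rw [hinterp, mul_div_cancel_left₀ _ hN]
    refine sum_congr rfl fun k _ => ?_
    rw [← hnode k]
    ring
  rw [hsum, Polynomial.eval_sub, sub_div, div_self hN, prod_div_distrib, Lagrange.eval_nodal,
    Lagrange.eval_nodal]
  simp_rw [sub_sub]

theorem Generic.sum_Qm_div {n : ℕ} {t : Fin n → ℂ} (ht : Generic t) (i : Fin n) :
    ∑ k, Qm t k / (t i - t k + 1) = 1 := by
  have hx (k : Fin n) : t i + 1 ≠ t k := by
    intro h
    have hik : i ≠ k := by
      rintro rfl
      simp at h
    refine ht i k hik (-1) ?_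
    push_cast
    linear_combination h
  have h := sum_Qm_div_sub ht.injective hx
  rw [prod_eq_zero (mem_univ i) (by simp), sub_zero] at h
  simpa only [sub_add_eq_add_sub] using h

/-- The trace of `Ψ̂` over the second tensor factor is the diagonal matrix `Q⁺`. -/
theorem Psi_trace_second_eq_Qp {n : ℕ} (hn : 2 ≤ n) (t : Fin n → ℂ) (ht : Generic t)
    (i j : Fin n) :
    ∑ k : Fin n, Psi t i k j k = if i = j then Qp t i else 0 := by
  have hterm (k : Fin n) :
      Psi t i k j k = if i = j then Qp t i * (Qm t k / (t i - t k + 1)) else 0 := by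
    have hswap : ¬(j = k ∧ k = i ∧ i ≠ k) := fun h => h.2.2 h.2.1.symm
    rw [Psi, if_neg hswap, add_zero]
    simp only [and_true, mul_div_assoc, eq_comm (a := j)]
  simp_rw [hterm]
  split_ifs
  · rw [← mul_sum, ht.sum_Qm_div, mul_one]
  · exact sum_const_zero
end
end

section
/- For every generic t ∈ ℂⁿ and all indices m, p ∈ {1,…,n}: Σ_a Q⁻_a(t − ε_m) · R̂^{ma}_{pa}(t) = δ^m_p, and likewise Σ_a Q⁺_a(t + ε_m) · R̂^{am}_{ap}(t) = δ^m_p. -/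
noncomputable section

open Finset

open Polynomial in
/-- The polynomial `∏ (X - s k) - ∏ (X - s k - 1)`, written by Lagrange interpolation at the nodes
`s k` and evaluated at `s m + 1`. -/
theorem sum_Qm_mul_inv {n : ℕ} (s : Fin n → ℂ) (hs : Function.Injective s) (m : Fin n)
    (hm : ∀ a, s m + 1 ≠ s a) : ∑ a, Qm s a * (s m + 1 - s a)⁻¹ = 1 := by
  set N : ℂ[X] := Lagrange.nodal univ s
  set P : ℂ[X] := Lagrange.nodal univ (fun k => s k + 1)
  have hdeg : (N - P).degree < #(univ : Finset (Fin n)) := by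
    have h := degree_sub_lt_left (p := N) (q := P)
      (by simp only [N, P, Lagrange.degree_nodal]) Lagrange.nodal_ne_zero
      (by simp only [N, P, Lagrange.nodal_monic.leadingCoeff])
    rwa [Lagrange.degree_nodal] at h
  have hN : N.eval (s m + 1) ≠ 0 :=
    Lagrange.eval_nodal_not_at_node fun a _ => hm a
  have hP : P.eval (s m + 1) = 0 :=
    Lagrange.eval_nodal_at_node (v := fun k => s k + 1) (mem_univ m)
  have key := congrArg (eval (s m + 1)) (Lagrange.eq_interpolate hs.injOn hdeg)
  rw [Lagrange.eval_interpolate_not_at_node _ fun a _ => hm a, eval_sub, hP, sub_zero] at key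
  refine .trans (sum_congr rfl fun a _ => ?_) (mul_left_cancel₀ hN ((mul_one _).trans key)).symm
  have hPa : P.eval (s a) = -∏ k ∈ univ.erase a, (s a - s k - 1) := by
    rw [Lagrange.eval_nodal, ← mul_prod_erase _ _ (mem_univ a)]
    simp [sub_sub]
  rw [eval_sub, Lagrange.eval_nodal_at_node (mem_univ a), hPa, Lagrange.nodalWeight, Qm,
    filter_ne', prod_div_distrib, prod_inv_distrib]
  ring

theorem Qm_neg {n : ℕ} (s : Fin n → ℂ) (a : Fin n) : Qm (-s) a = Qp s a := by
  refine prod_congr rfl fun k _ => ?_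
  rw [← neg_div_neg_eq]
  simp only [Pi.neg_apply]
  ring_nf

theorem sum_Qp_mul_inv {n : ℕ} (s : Fin n → ℂ) (hs : Function.Injective s) (m : Fin n)
    (hm : ∀ a, s a + 1 ≠ s m) : ∑ a, Qp s a * (s a - s m + 1)⁻¹ = 1 := by
  refine .trans (sum_congr rfl fun a _ => ?_)
    (sum_Qm_mul_inv (-s) (neg_injective.comp hs) m fun a h => hm a ?_)
  · rw [Qm_neg]
    simp only [Pi.neg_apply]
    ring_nf
  · simp only [Pi.neg_apply] at h
    linear_combination h

/-- An integral shift of a generic vector is generic. -/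
theorem Generic.of_sub_eq {n : ℕ} {t s : Fin n → ℂ} (ht : Generic t) (e : Fin n → ℤ)
    (hs : ∀ i, s i = t i + e i) : Generic s := by
  intro i j hij c h
  refine ht i j hij (c - e i + e j) ?_
  rw [hs, hs] at h
  push_cast
  linear_combination h

theorem Generic.add_one_ne {n : ℕ} {t : Fin n → ℂ} (ht : Generic t) (i j : Fin n) :
    t i + 1 ≠ t j := by
  intro h
  rcases eq_or_ne i j with rfl | hij
  · simp at h
  · exact ht i j hij (-1) (by push_cast; linear_combination h)

theorem Generic.sub_eps {n : ℕ} {t : Fin n → ℂ} (ht : Generic t) (m : Fin n) :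
    Generic (t - eps m) :=
  ht.of_sub_eq (fun i => if i = m then -1 else 0) fun i => by
    by_cases h : i = m <;> simp [eps, h, sub_eq_add_neg]

theorem Generic.add_eps {n : ℕ} {t : Fin n → ℂ} (ht : Generic t) (m : Fin n) :
    Generic (t + eps m) :=
  ht.of_sub_eq (fun i => if i = m then 1 else 0) fun i => by
    by_cases h : i = m <;> simp [eps, h]

theorem Rhat_trace_right {n : ℕ} (t : Fin n → ℂ) (m p a : Fin n) :
    Rhat t m a p a = if m = p then ((t - eps m) m + 1 - (t - eps m) a)⁻¹ else 0 := by
  by_cases hp : m = p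
  · subst hp
    by_cases ha : a = m
    · subst ha; simp [Rhat]
    · simp [Rhat, eps, ha, Ne.symm ha]
  · have h : ¬ (p = a ∧ a = m) := fun h => hp (h.1.trans h.2).symm
    simp [Rhat, hp, Ne.symm hp, h]

theorem Rhat_trace_left {n : ℕ} (t : Fin n → ℂ) (m p a : Fin n) :
    Rhat t a m a p = if m = p then ((t + eps m) a - (t + eps m) m + 1)⁻¹ else 0 := by
  by_cases hp : m = p
  · subst hp
    by_cases ha : a = m
    · subst ha; simp [Rhat]
    · simp [Rhat, eps, ha, sub_add_eq_sub_sub]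
  · have h : ¬ (a = m ∧ p = a) := fun h => hp (h.2.trans h.1).symm
    simp [Rhat, hp, Ne.symm hp, h]

/-- `Σ_a Q⁻_a(t - ε_m) R̂^{ma}_{pa}(t) = δ^m_p` and `Σ_a Q⁺_a(t + ε_m) R̂^{am}_{ap}(t) = δ^m_p`. -/
theorem Q_weighted_traces_of_Rhat {n : ℕ} (hn : 2 ≤ n) (t : Fin n → ℂ) (ht : Generic t)
    (m p : Fin n) :
    (∑ a : Fin n, Qm (t - eps m) a * Rhat t m a p a = if m = p then 1 else 0) ∧
    (∑ a : Fin n, Qp (t + eps m) a * Rhat t a m a p = if m = p then 1 else 0) := by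
  simp only [Rhat_trace_right, Rhat_trace_left]
  split_ifs
  · exact ⟨sum_Qm_mul_inv _ (ht.sub_eps m).injective m fun a => (ht.sub_eps m).add_one_ne m a,
      sum_Qp_mul_inv _ (ht.add_eps m).injective m fun a => (ht.add_eps m).add_one_ne a m⟩
  · simp
end
end

section
/- For every generic t ∈ ℂⁿ and all indices i, k, j, l ∈ {1,…,n}: Q⁺_i(t − ε_i) · Q⁺_k(t − ε_i − ε_k) · R̂^{ik}_{jl}(t) = R̂^{ik}_{jl}(t) · Q⁺_j(t − ε_j) · Q⁺_l(t − ε_j − ε_l). -/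
noncomputable section

open Finset

/-- Split off the factor with index `k` from the product defining `Qp`. -/
theorem Qp_eq_mul_prod {n : ℕ} (s : Fin n → ℂ) {i k : Fin n} (h : i ≠ k) :
    Qp s i = ((s i - s k) + 1) / (s i - s k) *
      ∏ m ∈ univ.filter (fun m => m ≠ i ∧ m ≠ k), ((s i - s m) + 1) / (s i - s m) := by
  have hk : k ∈ univ.filter (fun m => m ≠ i) := by simp [h.symm]
  rw [Qp, ← mul_prod_erase _ _ hk]
  congr 2
  ext m
  simp [and_comm]

/-- The product of two successive shifted factors, in a form symmetric in `i` and `k`. -/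
theorem Qp_mul_Qp_shift {n : ℕ} {t : Fin n → ℂ} (ht : Generic t) {i k : Fin n} (h : i ≠ k) :
    Qp (t - eps i) i * Qp (t - eps i - eps k) k =
      ∏ m ∈ univ.filter (fun m => m ≠ i ∧ m ≠ k),
        ((t i - t m) / (t i - t m - 1) * ((t k - t m) / (t k - t m - 1))) := by
  have h0 : t i - t k ≠ 0 := by simpa using ht i k h 0
  have h1 : t i - t k - 1 ≠ 0 := sub_ne_zero.mpr (by simpa using ht i k h 1)
  have h2 : t k - t i ≠ 0 := by simpa using ht k i h.symm 0
  have hi : ∏ m ∈ univ.filter (fun m => m ≠ i ∧ m ≠ k),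
      (((t - eps i) i - (t - eps i) m) + 1) / ((t - eps i) i - (t - eps i) m) =
      ∏ m ∈ univ.filter (fun m => m ≠ i ∧ m ≠ k), (t i - t m) / (t i - t m - 1) := by
    refine prod_congr rfl fun m hm => ?_
    obtain ⟨hmi, -⟩ := (mem_filter.mp hm).2
    simp only [Pi.sub_apply, eps, if_true, if_neg hmi]
    congr 1 <;> ring
  have hk : ∏ m ∈ univ.filter (fun m => m ≠ k ∧ m ≠ i),
      (((t - eps i - eps k) k - (t - eps i - eps k) m) + 1) /
        ((t - eps i - eps k) k - (t - eps i - eps k) m) =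
      ∏ m ∈ univ.filter (fun m => m ≠ i ∧ m ≠ k), (t k - t m) / (t k - t m - 1) := by
    refine prod_congr (by ext m; simp [and_comm]) fun m hm => ?_
    obtain ⟨hmi, hmk⟩ := (mem_filter.mp hm).2
    simp only [Pi.sub_apply, eps, if_true, if_neg hmi, if_neg hmk, if_neg h.symm]
    congr 1 <;> ring
  have hik : (((t - eps i) i - (t - eps i) k) + 1) / ((t - eps i) i - (t - eps i) k) *
      ((((t - eps i - eps k) k - (t - eps i - eps k) i) + 1) /
        ((t - eps i - eps k) k - (t - eps i - eps k) i)) = 1 := by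
    simp only [Pi.sub_apply, eps, if_true, if_neg h, if_neg h.symm]
    have e1 : t i - 1 - (t k - 0) = t i - t k - 1 := by ring
    have e2 : t k - 0 - 1 - (t i - 1 - 0) = t k - t i := by ring
    rw [e1, e2]
    field_simp
    ring
  rw [Qp_eq_mul_prod _ h, Qp_eq_mul_prod _ h.symm, mul_mul_mul_comm, hik, one_mul, hi, hk,
    prod_mul_distrib]

theorem Qp_mul_Qp_shift_comm {n : ℕ} {t : Fin n → ℂ} (ht : Generic t) (i k : Fin n) :
    Qp (t - eps i) i * Qp (t - eps i - eps k) k =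
      Qp (t - eps k) k * Qp (t - eps k - eps i) i := by
  rcases eq_or_ne i k with rfl | h
  · rfl
  rw [Qp_mul_Qp_shift ht h, Qp_mul_Qp_shift ht h.symm]
  exact prod_congr (by ext m; simp [and_comm]) fun m _ => mul_comm _ _

/-- `Q⁺_i(t-ε_i) Q⁺_k(t-ε_i-ε_k) R̂^{ik}_{jl}(t) = R̂^{ik}_{jl}(t) Q⁺_j(t-ε_j) Q⁺_l(t-ε_j-ε_l)`. -/
theorem Qp_Rhat_commutation {n : ℕ} (hn : 2 ≤ n) (t : Fin n → ℂ) (ht : Generic t)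
    (i k j l : Fin n) :
    Qp (t - eps i) i * Qp (t - eps i - eps k) k * Rhat t i k j l
    = Rhat t i k j l * Qp (t - eps j) j * Qp (t - eps j - eps l) l := by
  by_cases h : j = i ∧ l = k
  · obtain ⟨rfl, rfl⟩ := h
    ring
  by_cases h' : j = k ∧ l = i
  · obtain ⟨rfl, rfl⟩ := h'
    rw [Qp_mul_Qp_shift_comm ht]
    ring
  have hR : Rhat t i k j l = 0 := by
    rw [Rhat, if_neg fun hh => h ⟨hh.1, hh.2.1⟩, if_neg h', add_zero]
  simp [hR]
end
end

section
/- For every generic t ∈ ℂⁿ and all indices i, k, j, l ∈ {1,…,n}: Ψ̂^{ik}_{jl}(t) = Q⁺_i(t + ε_k − ε_l) · R̂^{ik}_{jl}(t + ε_j) · Q⁺_l(t − ε_l)^{−1}. -/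
noncomputable section

open Finset

theorem inv_Qp_sub_eps {n : ℕ} (t : Fin n → ℂ) (l : Fin n) :
    (Qp (t - eps l) l)⁻¹ = Qm t l := by
  unfold Qp Qm
  rw [← Finset.prod_inv_distrib]
  refine Finset.prod_congr rfl fun m hm => ?_
  have hml : m ≠ l := (Finset.mem_filter.mp hm).2
  simp only [Pi.sub_apply, eps, if_neg hml, if_true, inv_div]
  congr 1 <;> ring

theorem Qm_ne_zero {n : ℕ} {t : Fin n → ℂ} (ht : Generic t) (l : Fin n) : Qm t l ≠ 0 := by
  refine Finset.prod_ne_zero_iff.mpr fun m hm => ?_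
  have hml : l ≠ m := (Finset.mem_filter.mp hm).2.symm
  have h0 := ht l m hml 0
  have h1 := ht l m hml 1
  push_cast at h0 h1
  exact div_ne_zero (sub_ne_zero.mpr h1) h0

theorem Qp_add_eps_sub_eps {n : ℕ} {t : Fin n → ℂ} (ht : Generic t) {i k : Fin n}
    (hik : i ≠ k) :
    Qp (t + eps k - eps i) i = Qp (t - eps i) i *
      (((t i - t k) - 1) ^ 2 / ((t i - t k) * ((t i - t k) - 2))) := by
  have hk : k ∈ Finset.univ.filter (fun m => m ≠ i) := by simp [hik.symm]
  have h0 := ht i k hik 0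
  have h1 := ht i k hik 1
  have h2 := ht i k hik 2
  push_cast at h0 h1 h2
  have h1' := sub_ne_zero.mpr h1
  have h2' := sub_ne_zero.mpr h2
  unfold Qp
  rw [← Finset.mul_prod_erase _ _ hk, ← Finset.mul_prod_erase _ _ hk, mul_right_comm]
  congr 1
  · have e1 : (t + eps k - eps i) i - (t + eps k - eps i) k = t i - t k - 2 := by
      simp [eps, hik, hik.symm]; ring
    have e2 : (t - eps i) i - (t - eps i) k = t i - t k - 1 := by
      simp [eps, hik.symm]; ring
    rw [e1, e2]
    generalize t i - t k = x at *
    field_simp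
    ring
  · refine Finset.prod_congr rfl fun m hm => ?_
    have hmk : m ≠ k := (Finset.mem_erase.mp hm).1
    simp [eps, hik, hmk]

/-- `Ψ̂^{ik}_{jl}(t) = Q⁺_i(t + ε_k - ε_l) · R̂^{ik}_{jl}(t + ε_j) · Q⁺_l(t - ε_l)⁻¹`. -/
theorem Psi_eq_Qp_Rhat_Qp_inv {n : ℕ} (hn : 2 ≤ n) (t : Fin n → ℂ) (ht : Generic t)
    (i k j l : Fin n) :
    Psi t i k j l
    = Qp (t + eps k - eps l) i * Rhat (t + eps j) i k j l * (Qp (t - eps l) l)⁻¹ := by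
  rw [inv_Qp_sub_eps]
  by_cases hik : i = k
  · subst hik
    by_cases h : j = i ∧ l = i
    · obtain ⟨rfl, rfl⟩ := h
      simp [Psi, Rhat]
    · simp [Psi, Rhat, h]
  · by_cases h : j = i ∧ l = k
    · obtain ⟨rfl, rfl⟩ := h
      have e : (t + eps j) j - (t + eps j) l = t j - t l + 1 := by
        simp [eps, Ne.symm hik]; ring
      simp only [Psi, Rhat, e]
      simp [hik]
      ring
    · by_cases h' : j = k ∧ l = i
      · obtain ⟨rfl, rfl⟩ := h'
        have e : (t + eps j) l - (t + eps j) j = t l - t j - 1 := by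
          simp [eps, hik]; ring
        have hQ : Qp (t - eps l) l = (Qm t l)⁻¹ := by rw [← inv_Qp_sub_eps, inv_inv]
        have hm := Qm_ne_zero ht l
        have h0 := ht l j hik 0
        have h1 := ht l j hik 1
        have h2 := ht l j hik 2
        push_cast at h0 h1 h2
        have h1' := sub_ne_zero.mpr h1
        have h2' := sub_ne_zero.mpr h2
        rw [Qp_add_eps_sub_eps ht hik, hQ]
        simp only [Psi, Rhat, e, if_neg h]
        simp only [hik, Ne.symm hik, ne_eq, false_and, not_false_eq_true, and_self,
          if_true, if_false, zero_add]
        generalize t l - t j = x at *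
        split_ifs
        · field_simp
          ring
        · field_simp
      · have h₁ : ¬(j = i ∧ l = k ∧ i ≠ k) := fun c => h ⟨c.1, c.2.1⟩
        have h₂ : ¬(j = k ∧ l = i ∧ i ≠ k) := fun c => h' ⟨c.1, c.2.1⟩
        simp only [Psi, Rhat, if_neg h, if_neg h', if_neg h₁, if_neg h₂]
        simp
end
end

section
/- For every generic t ∈ ℂⁿ and every index i ∈ {1,…,n}: Σ_{j=1}^n Q⁻_j(t)/(1 + t_{ij}) = 1 (the j = i term being Q⁻_i(t), since t_{ii} = 0). -/
noncomputable section

open Finset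

/-- The divided difference of a monic product of `n - 1` linear factors at `n` nodes is `1`. -/
theorem sum_prod_erase_sub_div_prod_erase_sub {ι F : Type*} [Field F] [DecidableEq ι]
    {s : Finset ι} {v : ι → F} (hv : Set.InjOn v s) (w : ι → F) {i : ι} (hi : i ∈ s) :
    ∑ j ∈ s, (∏ k ∈ s.erase i, (v j - w k)) / ∏ k ∈ s.erase j, (v j - v k) = 1 := by
  have hdeg : (#s : WithBot ℕ) = (Lagrange.nodal (s.erase i) w).degree + 1 := by
    rw [Lagrange.degree_nodal, ← card_erase_add_one hi]
    push_cast
    rfl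
  have h := Lagrange.leadingCoeff_eq_sum hv hdeg
  rw [Lagrange.nodal_monic.leadingCoeff] at h
  simpa only [Lagrange.eval_nodal] using h.symm

/-- Cancelling the factor `1 + (t i - t j)` in `Q⁻_j`. -/
theorem Qm_div_eq {n : ℕ} {t : Fin n → ℂ} (ht : Generic t) (i j : Fin n) :
    Qm t j / (1 + (t i - t j)) =
      (∏ k ∈ univ.erase i, (t j - (t k + 1))) / ∏ k ∈ univ.erase j, (t j - t k) := by
  have hne : 1 + (t i - t j) ≠ 0 := by
    intro h
    rcases eq_or_ne i j with rfl | hij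
    · simp at h
    · exact ht i j hij (-1) (by push_cast; linear_combination h)
  have hi := mul_prod_erase univ (fun k => t j - (t k + 1)) (mem_univ i)
  have hj := mul_prod_erase univ (fun k => t j - (t k + 1)) (mem_univ j)
  have hQ : Qm t j =
      (∏ k ∈ univ.erase j, (t j - (t k + 1))) / ∏ k ∈ univ.erase j, (t j - t k) := by
    rw [Qm, filter_ne', prod_div_distrib]
    simp only [sub_sub]
  rw [hQ, div_right_comm]
  congr 1
  rw [div_eq_iff hne]
  linear_combination hi - hj

/-- `Σ_{j=1}^n Q⁻_j(t)/(1 + t_{ij}) = 1`. -/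
theorem sum_Qm_div_eq_one {n : ℕ} (hn : 2 ≤ n) (t : Fin n → ℂ) (ht : Generic t)
    (i : Fin n) :
    ∑ j : Fin n, Qm t j / (1 + (t i - t j)) = 1 := by
  have hinj : Function.Injective t := fun a b hab => by
    by_contra h
    exact ht a b h 0 (by simp [hab])
  simp only [Qm_div_eq ht]
  exact sum_prod_erase_sub_div_prod_erase_sub hinj.injOn (fun k => t k + 1) (mem_univ i)
end
end

section
/- For every generic t ∈ ℂⁿ: Σ_{j=1}^n Q⁻_j(t) = n and Σ_{j=1}^n Q⁺_j(t) = n; explicitly, Σ_{j} ∏_{k ≠ j} (t_{jk} − 1)/t_{jk} = n and Σ_{j} ∏_{k ≠ j} (t_{jk} + 1)/t_{jk} = n. -/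
noncomputable section

open Finset

open Polynomial in
/-- For pairwise distinct nodes `v i`, the products `∏_{k ≠ j} (v j - v k + c) / (v j - v k)` with
`c ≠ 0` sum to the number of nodes: compare the coefficients of degree `#s - 1` in the Lagrange
interpolation of `∏ (X - v k + c) - ∏ (X - v k)`. -/
theorem Lagrange.sum_prod_sub_add_div_sub {F ι : Type*} [Field F] [DecidableEq ι] {s : Finset ι}
    {v : ι → F} (hv : Set.InjOn v s) {c : F} (hc : c ≠ 0) :
    ∑ j ∈ s, ∏ k ∈ s.erase j, (v j - v k + c) / (v j - v k) = (#s : F) := by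
  rcases s.eq_empty_or_nonempty with rfl | hs
  · simp
  have hpos : 0 < #s := hs.card_pos
  set P : F[X] := nodal s (fun k => v k - c) - nodal s v with hP
  have hdeg : P.degree < #s := by
    rw [← degree_nodal (s := s) (v := fun k => v k - c)]
    exact degree_sub_lt_left (by simp only [degree_nodal]) nodal_ne_zero
      (by rw [nodal_monic.leadingCoeff, nodal_monic.leadingCoeff])
  have hcoeff : P.coeff (#s - 1) = #s * c := by
    rw [hP, coeff_sub, nodal_eq, nodal_eq, prod_X_sub_C_coeff_card_pred _ _ hpos,
      prod_X_sub_C_coeff_card_pred _ _ hpos, sum_sub_distrib, sum_const, nsmul_eq_mul]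
    ring
  have heval : ∀ j ∈ s, P.eval (v j) = c * ∏ k ∈ s.erase j, (v j - v k + c) := by
    intro j hj
    rw [hP, eval_sub, eval_nodal_at_node hj, eval_nodal, sub_zero, ← mul_prod_erase s _ hj,
      sub_sub_cancel]
    exact congrArg _ (prod_congr rfl fun k _ => by ring)
  have hsum := Lagrange.coeff_eq_sum hv hdeg
  rw [hcoeff] at hsum
  apply mul_right_cancel₀ hc
  rw [hsum, sum_mul]
  refine sum_congr rfl fun j hj => ?_
  rw [heval j hj, prod_div_distrib]
  ring

/-- `Σ_j Q⁻_j(t) = n` and `Σ_j Q⁺_j(t) = n`. -/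
theorem sum_Qm_eq_n_and_sum_Qp_eq_n {n : ℕ} (hn : 2 ≤ n) (t : Fin n → ℂ) (ht : Generic t) :
    (∑ j : Fin n, Qm t j = (n : ℂ)) ∧ (∑ j : Fin n, Qp t j = (n : ℂ)) := by
  have key (c : ℂ) (hc : c ≠ 0) :=
    Lagrange.sum_prod_sub_add_div_sub (s := univ) (v := t) ht.injective.injOn hc
  simp only [card_univ, Fintype.card_fin] at key
  constructor
  · simpa only [Qm, filter_ne', ← sub_eq_add_neg] using key (-1) (by norm_num)
  · simpa only [Qp, filter_ne'] using key 1 one_ne_zero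
end
end
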